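/- arXiv:math-ph/0610031 — 2 statements merged into one kernel-verified Lean document; each statement's English description precedes it below -/
import Mathlib

section
/- Let ξ be a real random variable with E[|ξ|³] < ∞ and E[ξ] = 0. Let F : ℝ → ℝ be twice continuously differentiable with ‖F''‖_∞ = sup_{x∈ℝ} |F''(x)| < ∞. Then |E[ξ·F(ξ)] − E[ξ²]·E[F'(ξ)]| ≤ (3/2)·‖F''‖_∞·E[|ξ|³]. -/
open MeasureTheory

lemma taylor_aux_pos (f f' : ℝ → ℝ) (M : ℝ) (hf : ∀ x, HasDerivAt f (f' x) x)
    (hb : ∀ x, |f' x - f' 0| ≤ M * |x|) (x : ℝ) (hx : 0 ≤ x) :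
    |f x - f 0 - f' 0 * x| ≤ M / 2 * x ^ 2 := by
  have hg : ∀ y, HasDerivAt (fun y => f y - f 0 - f' 0 * y) (f' y - f' 0) y := by
    intro y
    have := ((hf y).sub_const (f 0)).sub ((hasDerivAt_id y).const_mul (f' 0))
    exact this.congr_deriv (by simp)
  have hB : ∀ y, HasDerivAt (fun y : ℝ => M / 2 * y ^ 2) (M * y) y := by
    intro y
    have := (hasDerivAt_pow 2 y).const_mul (M / 2)
    refine this.congr_deriv ?_
    norm_num
    ring
  have := image_norm_le_of_norm_deriv_right_le_deriv_boundary (a := 0) (b := x)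
    (f := fun y => f y - f 0 - f' 0 * y) (f' := fun y => f' y - f' 0)
    (B := fun y : ℝ => M / 2 * y ^ 2) (B' := fun y => M * y)
    (fun y _ => (hg y).continuousAt.continuousWithinAt)
    (fun y _ => (hg y).hasDerivWithinAt) (by simp) hB
    (fun y hy => by
      have := hb y
      rw [abs_of_nonneg hy.1] at this
      simpa using this)
  simpa using this (Set.right_mem_Icc.2 hx)

lemma taylor_aux (f f' : ℝ → ℝ) (M : ℝ) (hf : ∀ x, HasDerivAt f (f' x) x)
    (hb : ∀ x, |f' x - f' 0| ≤ M * |x|) (x : ℝ) :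
    |f x - f 0 - f' 0 * x| ≤ M / 2 * x ^ 2 := by
  rcases le_total 0 x with hx | hx
  · exact taylor_aux_pos f f' M hf hb x hx
  · have := taylor_aux_pos (fun y => f (-y)) (fun y => - f' (-y)) M
      (fun y => by
        have := (hf (-y)).comp y (hasDerivAt_neg y)
        simpa [Function.comp_def] using this)
      (fun y => by
        have := hb (-y)
        rw [abs_neg] at this
        rw [← abs_neg]
        convert this using 2
        simp
        ring) (-x) (by linarith)
    simpa using this

/-- Generalized integration-by-parts: if `ξ` is a centered real random variable with finite
third moment and `F` is `C²` with bounded second derivative, then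
`|E[ξ·F(ξ)] − E[ξ²]·E[F'(ξ)]| ≤ (3/2)·‖F''‖_∞·E[|ξ|³]`. -/
theorem abs_integral_mul_sub_le_of_bddAbove_iteratedDeriv
    {Ω : Type*} [MeasurableSpace Ω] (μ : Measure Ω) [IsProbabilityMeasure μ]
    (ξ : Ω → ℝ) (hξ : Measurable ξ)
    (h3 : Integrable (fun ω => |ξ ω| ^ 3) μ)
    (hmean : ∫ ω, ξ ω ∂μ = 0)
    (F : ℝ → ℝ) (hF : ContDiff ℝ 2 F)
    (hbdd : BddAbove (Set.range fun x => |iteratedDeriv 2 F x|)) :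
    |(∫ ω, ξ ω * F (ξ ω) ∂μ) - (∫ ω, (ξ ω) ^ 2 ∂μ) * ∫ ω, deriv F (ξ ω) ∂μ| ≤
      (3 / 2) * (⨆ x, |iteratedDeriv 2 F x|) * ∫ ω, |ξ ω| ^ 3 ∂μ := by
  set M := ⨆ x, |iteratedDeriv 2 F x| with hM
  have hM2 : ∀ x, |iteratedDeriv 2 F x| ≤ M := fun x => le_ciSup hbdd x
  have hM0 : 0 ≤ M := (abs_nonneg _).trans (hM2 0)
  have hF1 : ∀ x, HasDerivAt F (deriv F x) x := fun x =>
    (hF.differentiable (by norm_num) x).hasDerivAt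
  have hdF : ContDiff ℝ 1 (deriv F) := by
    have : ContDiff ℝ (1 + 1) F := by simpa [one_add_one_eq_two] using hF
    exact (contDiff_succ_iff_deriv.1 this).2.2
  have hb : ∀ x, |deriv F x - deriv F 0| ≤ M * |x| := by
    intro x
    have := convex_univ.norm_image_sub_le_of_norm_deriv_le (f := deriv F) (C := M)
      (fun y _ => hdF.differentiable (by norm_num) y)
      (fun y _ => by
        have := hM2 y
        rwa [iteratedDeriv_succ, iteratedDeriv_one] at this) (Set.mem_univ 0) (Set.mem_univ x)
    simpa using this
  have hT := taylor_aux F (deriv F) M hF1 hb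
  have i1 : Integrable (fun ω => |ξ ω|) μ := by
    refine ((integrable_const (1:ℝ)).add h3).mono' (by fun_prop) (ae_of_all _ fun ω => ?_)
    have := abs_nonneg (ξ ω)
    simp only [Real.norm_eq_abs, abs_abs, Pi.add_apply]
    nlinarith [mul_nonneg this (sq_nonneg (|ξ ω| - 1)), sq_nonneg (|ξ ω| - 1)]
  have i2 : Integrable (fun ω => (ξ ω) ^ 2) μ := by
    refine ((integrable_const (1:ℝ)).add h3).mono' (by fun_prop) (ae_of_all _ fun ω => ?_)
    have := abs_nonneg (ξ ω)
    simp only [Real.norm_eq_abs, abs_pow, Pi.add_apply]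
    nlinarith [mul_nonneg this (sq_nonneg (|ξ ω| - 1)), sq_nonneg (|ξ ω| - 1)]
  have i0 : Integrable ξ μ := (integrable_norm_iff (by fun_prop)).1 i1
  have mF : Measurable F := hF.continuous.measurable
  have mD : Measurable (deriv F) := measurable_deriv F
  have bR : ∀ ω, |ξ ω * (F (ξ ω) - F 0 - deriv F 0 * ξ ω)| ≤ M / 2 * |ξ ω| ^ 3 := by
    intro ω
    rw [abs_mul]
    have := mul_le_mul_of_nonneg_left (hT (ξ ω)) (abs_nonneg (ξ ω))
    rw [← sq_abs (ξ ω)] at this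
    linarith
  have iR : Integrable (fun ω => ξ ω * (F (ξ ω) - F 0 - deriv F 0 * ξ ω)) μ :=
    (h3.const_mul (M / 2)).mono' (by fun_prop) (ae_of_all _ bR)
  have iS : Integrable (fun ω => deriv F (ξ ω) - deriv F 0) μ :=
    (i1.const_mul M).mono' (by fun_prop) (ae_of_all _ fun ω => hb (ξ ω))
  have eR : ∫ ω, ξ ω * F (ξ ω) ∂μ
      = (∫ ω, ξ ω * (F (ξ ω) - F 0 - deriv F 0 * ξ ω) ∂μ) + deriv F 0 * ∫ ω, (ξ ω) ^ 2 ∂μ := by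
    have h : ∀ ω, ξ ω * F (ξ ω) = (ξ ω * (F (ξ ω) - F 0 - deriv F 0 * ξ ω)
        + F 0 * ξ ω) + deriv F 0 * (ξ ω) ^ 2 := fun ω => by ring
    simp_rw [h]
    rw [integral_add (f := fun ω => ξ ω * (F (ξ ω) - F 0 - deriv F 0 * ξ ω) + F 0 * ξ ω)
      (iR.add (i0.const_mul _)) (i2.const_mul _),
      integral_add iR (i0.const_mul _), integral_const_mul, integral_const_mul, hmean]
    ring
  have eS : ∫ ω, deriv F (ξ ω) ∂μ = (∫ ω, (deriv F (ξ ω) - deriv F 0) ∂μ) + deriv F 0 := by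
    have h : ∀ ω, deriv F (ξ ω) = (deriv F (ξ ω) - deriv F 0) + deriv F 0 := fun ω => by ring
    conv_lhs => enter [2, ω]; rw [h ω]
    rw [integral_add iS (integrable_const _)]
    simp
  have nR : |∫ ω, ξ ω * (F (ξ ω) - F 0 - deriv F 0 * ξ ω) ∂μ| ≤ M / 2 * ∫ ω, |ξ ω| ^ 3 ∂μ := by
    rw [← integral_const_mul]
    rw [← Real.norm_eq_abs]
    exact norm_integral_le_of_norm_le (h3.const_mul (M / 2)) (ae_of_all _ bR)
  have nS : |∫ ω, (deriv F (ξ ω) - deriv F 0) ∂μ| ≤ M * ∫ ω, |ξ ω| ∂μ := by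
    rw [← integral_const_mul]
    rw [← Real.norm_eq_abs]
    exact norm_integral_le_of_norm_le (i1.const_mul M) (ae_of_all _ fun ω => hb (ξ ω))
  have s0 : 0 ≤ ∫ ω, (ξ ω) ^ 2 ∂μ := integral_nonneg fun ω => sq_nonneg _
  have key : (∫ ω, (ξ ω) ^ 2 ∂μ) * ∫ ω, |ξ ω| ∂μ ≤ ∫ ω, |ξ ω| ^ 3 ∂μ := by
    set m := ∫ ω, |ξ ω| ∂μ with hm
    have m0 : 0 ≤ m := integral_nonneg fun ω => abs_nonneg _
    have h : ∫ ω, (m * (ξ ω) ^ 2 + m ^ 2 * |ξ ω|) ∂μ ≤ ∫ ω, (|ξ ω| ^ 3 + m ^ 3) ∂μ := by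
      refine integral_mono ((i2.const_mul _).add (i1.const_mul _))
        (h3.add (integrable_const _)) fun ω => ?_
      have := mul_nonneg (add_nonneg (abs_nonneg (ξ ω)) m0) (sq_nonneg (|ξ ω| - m))
      simp only
      rw [← sq_abs (ξ ω)]
      linarith
    rw [integral_add (i2.const_mul _) (i1.const_mul _), integral_add h3 (integrable_const _),
      integral_const_mul, integral_const_mul, ← hm] at h
    simp at h
    linarith
  rw [eR, eS]
  generalize (∫ ω, ξ ω * (F (ξ ω) - F 0 - deriv F 0 * ξ ω) ∂μ) = R at *
  generalize (∫ ω, (deriv F (ξ ω) - deriv F 0) ∂μ) = S at *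
  have e : R + deriv F 0 * (∫ ω, (ξ ω) ^ 2 ∂μ) - (∫ ω, (ξ ω) ^ 2 ∂μ) * (S + deriv F 0)
      = R - (∫ ω, (ξ ω) ^ 2 ∂μ) * S := by ring
  rw [e]
  refine (abs_sub _ _).trans ?_
  rw [abs_mul, abs_of_nonneg s0]
  have h1 := mul_le_mul_of_nonneg_left nS s0
  have h2 := mul_le_mul_of_nonneg_left key hM0
  linarith
end

section
/- Let k ≥ 1 and let B_1,…,B_{2k} be complex square matrices of the same finite size. Then |Tr(B_1 B_2 ⋯ B_{2k})| ≤ Π_{j=1}^{2k} (Tr((B_j B_j*)^k))^{1/(2k)}, where B_j* denotes the conjugate transpose of B_j. -/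
open Matrix

set_option linter.unusedSectionVars false

namespace TraceHolder

variable {n : Type*} [Fintype n] [DecidableEq n]

/-- Cauchy–Schwarz for the trace. -/
lemma trace_cs (Y X : Matrix n n ℂ) :
    ‖(Y * X).trace‖ ^ 2 ≤ ‖(Y * Yᴴ).trace‖ * ‖(X * Xᴴ).trace‖ := by
  have key : ∀ Z : Matrix n n ℂ, ‖(Z * Zᴴ).trace‖ = ∑ p : n × n, ‖Z p.1 p.2‖ ^ 2 := by
    intro Z
    have h : (Z * Zᴴ).trace = ((∑ p : n × n, ‖Z p.1 p.2‖ ^ 2 : ℝ) : ℂ) := by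
      rw [Fintype.sum_prod_type]
      simp only [Matrix.trace, Matrix.diag, Matrix.mul_apply, Matrix.conjTranspose_apply]
      push_cast
      refine Finset.sum_congr rfl fun i _ => Finset.sum_congr rfl fun j _ => ?_
      exact Complex.mul_conj' _
    rw [h, Complex.norm_real, Real.norm_of_nonneg (by positivity)]
  have h1 : ‖(Y * X).trace‖ ≤ ∑ p : n × n, ‖Y p.1 p.2‖ * ‖X p.2 p.1‖ := by
    have : (Y * X).trace = ∑ p : n × n, Y p.1 p.2 * X p.2 p.1 := by
      rw [Fintype.sum_prod_type]
      simp only [Matrix.trace, Matrix.diag, Matrix.mul_apply]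
    rw [this]
    refine (norm_sum_le _ _).trans (le_of_eq ?_)
    simp
  have h2 : ∑ p : n × n, ‖X p.2 p.1‖ ^ 2 = ∑ p : n × n, ‖X p.1 p.2‖ ^ 2 := by
    rw [Fintype.sum_prod_type, Fintype.sum_prod_type, Finset.sum_comm]
  rw [key, key, ← h2]
  refine (pow_le_pow_left₀ (norm_nonneg _) h1 2).trans ?_
  exact Finset.sum_mul_sq_le_sq_mul_sq _ _ _

/-- The alternating word `A, Aᴴ, A, Aᴴ, …`. -/
def alt : Matrix n n ℂ → ℕ → List (Matrix n n ℂ)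
  | _, 0 => []
  | A, l + 1 => A :: alt Aᴴ l

/-- The reversed starred word. -/
def rs (w : List (Matrix n n ℂ)) : List (Matrix n n ℂ) := (w.map conjTranspose).reverse

lemma alt_length (A : Matrix n n ℂ) (l : ℕ) : (alt A l).length = l := by
  induction l generalizing A with
  | zero => rfl
  | succ l ih => simp [alt, ih]

lemma rs_length (w : List (Matrix n n ℂ)) : (rs w).length = w.length := by simp [rs]

lemma rs_prod (w : List (Matrix n n ℂ)) : (rs w).prod = (w.prod)ᴴ := by
  rw [Matrix.conjTranspose_list_prod, rs]

lemma alt_two_mul_append (A : Matrix n n ℂ) (l : ℕ) :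
    alt A (2 * l) ++ [A] = alt A (2 * l + 1) := by
  induction l with
  | zero => rfl
  | succ l ih =>
    show A :: Aᴴ :: (alt Aᴴᴴ (2 * l) ++ [A]) = A :: Aᴴ :: alt Aᴴᴴ (2 * l + 1)
    rw [conjTranspose_conjTranspose, ih]

lemma alt_append_rs (A : Matrix n n ℂ) (l : ℕ) : alt A l ++ rs (alt A l) = alt A (2 * l) := by
  induction l generalizing A with
  | zero => rfl
  | succ l ih =>
    have h : rs (alt A (l + 1)) = rs (alt Aᴴ l) ++ [Aᴴ] := by simp [rs, alt]
    rw [h]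
    show A :: (alt Aᴴ l ++ (rs (alt Aᴴ l) ++ [Aᴴ])) = A :: alt Aᴴ (2 * l + 1)
    rw [← List.append_assoc, ih, alt_two_mul_append]

lemma alt_prod (A : Matrix n n ℂ) (l : ℕ) : (alt A (2 * l)).prod = (A * Aᴴ) ^ l := by
  induction l with
  | zero => simp [alt]
  | succ l ih =>
    show (A :: Aᴴ :: (alt Aᴴᴴ (2 * l))).prod = _
    rw [conjTranspose_conjTranspose, List.prod_cons, List.prod_cons, ih, pow_succ', mul_assoc]

lemma main_bound (S : Set (Matrix n n ℂ)) (hfin : S.Finite) (hst : ∀ A ∈ S, Aᴴ ∈ S)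
    (k : ℕ) (hk : 1 ≤ k) (hS : ∀ A ∈ S, ‖((A * Aᴴ) ^ k).trace‖ ≤ 1)
    (w : List (Matrix n n ℂ)) (hw : ∀ A ∈ w, A ∈ S) (hl : w.length = 2 * k) :
    ‖w.prod.trace‖ ≤ 1 := by
  have hrs : ∀ v : List (Matrix n n ℂ), (∀ A ∈ v, A ∈ S) → ∀ A ∈ rs v, A ∈ S := by
    intro v hv A hA
    simp only [rs, List.mem_reverse, List.mem_map] at hA
    obtain ⟨a, ha, rfl⟩ := hA
    exact hst _ (hv a ha)
  -- a maximizing word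
  obtain ⟨w0, hw0, hl0, hmax⟩ : ∃ w0 : List (Matrix n n ℂ), (∀ A ∈ w0, A ∈ S) ∧
      w0.length = 2 * k ∧ ∀ v : List (Matrix n n ℂ), (∀ A ∈ v, A ∈ S) → v.length = 2 * k →
        ‖v.prod.trace‖ ≤ ‖w0.prod.trace‖ := by
    have : Finite S := hfin
    have hF := List.finite_length_eq S (2 * k)
    lift w to List S using hw
    obtain ⟨a, ha, hm⟩ := Set.exists_max_image _
      (fun l : List S => ‖((l.map Subtype.val).prod).trace‖) hF ⟨w, by simpa using hl⟩
    refine ⟨a.map Subtype.val, ?_, by simpa using ha, ?_⟩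
    · intro A hA
      obtain ⟨x, _, rfl⟩ := List.mem_map.1 hA
      exact x.2
    · intro v hv hvl
      lift v to List S using hv
      exact hm v (by simpa using hvl)
  refine (hmax w hw hl).trans ?_
  by_contra hM
  push Not at hM
  set M := ‖w0.prod.trace‖ with hMdef
  let P : ℕ → Prop := fun l => ∃ (u : List (Matrix n n ℂ)) (A : Matrix n n ℂ),
    A ∈ S ∧ (∀ C ∈ u ++ alt A l, C ∈ S) ∧ (u ++ alt A l).length = 2 * k ∧
      M ≤ ‖(u ++ alt A l).prod.trace‖
  have hP1 : P 1 := by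
    have hne : w0 ≠ [] := by
      rintro rfl
      simp at hl0
      omega
    have e : w0.dropLast ++ alt (w0.getLast hne) 1 = w0 := by
      simp [alt, List.dropLast_append_getLast]
    refine ⟨w0.dropLast, w0.getLast hne, hw0 _ (List.getLast_mem hne), ?_, ?_, ?_⟩ <;> rw [e]
    · exact hw0
    · exact hl0
  have hPdown : ∀ l, P (l + 1) → P l := by
    rintro l ⟨u, A, hA, h1, h2, h3⟩
    have e : (u ++ [A]) ++ alt Aᴴ l = u ++ alt A (l + 1) := by simp [alt]
    refine ⟨u ++ [A], Aᴴ, hst _ hA, ?_, ?_, ?_⟩ <;> rw [e] <;> assumption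
  have hPdouble : ∀ l, l ≤ k → P l → P (2 * l) := by
    rintro l hlk ⟨u, A, hA, h1, h2, h3⟩
    have hul : u.length = 2 * k - l := by
      rw [List.length_append, alt_length] at h2
      omega
    obtain ⟨y, v, rfl, hy, hv⟩ : ∃ y v, u = y ++ v ∧ y.length = k ∧ v.length = k - l :=
      ⟨u.take k, u.drop k, by simp, by simp; omega, by simp; omega⟩
    have hyS : ∀ C ∈ y, C ∈ S := fun C hC => h1 C (by simp [hC])
    have hvS : ∀ C ∈ v, C ∈ S := fun C hC => h1 C (by simp [hC])
    have haS : ∀ C ∈ alt A l, C ∈ S := fun C hC => h1 C (by simp [hC])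
    have hdS : ∀ C ∈ alt A (2 * l), C ∈ S := by
      intro C hC
      rw [← alt_append_rs, List.mem_append] at hC
      exact hC.elim (haS C) (hrs _ haS C)
    refine ⟨rs v ++ v, A, hA, ?_, ?_, ?_⟩
    · intro C hC
      rw [List.mem_append, List.mem_append] at hC
      rcases hC with (hC | hC) | hC
      · exact hrs v hvS C hC
      · exact hvS C hC
      · exact hdS C hC
    · simp only [List.length_append, rs_length, alt_length]
      omega
    · have cs := trace_cs y.prod (v ++ alt A l).prod
      rw [← List.prod_append, ← List.append_assoc] at cs
      have hyy : ‖(y.prod * y.prodᴴ).trace‖ ≤ M := by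
        rw [← rs_prod, ← List.prod_append]
        refine hmax _ ?_ ?_
        · intro C hC
          rw [List.mem_append] at hC
          exact hC.elim (hyS C) (hrs _ hyS C)
        · rw [List.length_append, rs_length]
          omega
      have hxx : ((v ++ alt A l).prod * (v ++ alt A l).prodᴴ).trace
          = (rs v ++ v ++ alt A (2 * l)).prod.trace := by
        rw [← alt_append_rs]
        simp only [List.prod_append, rs_prod, conjTranspose_mul]
        rw [← mul_assoc, Matrix.trace_mul_comm]
        simp only [mul_assoc]
      rw [hxx] at cs
      have hM2 : M ^ 2 ≤ ‖(y ++ v ++ alt A l).prod.trace‖ ^ 2 :=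
        pow_le_pow_left₀ (by linarith) h3 2
      have h5 : M * M ≤ M * ‖(rs v ++ v ++ alt A (2 * l)).prod.trace‖ := by
        calc M * M = M ^ 2 := by ring
          _ ≤ _ := hM2
          _ ≤ _ := cs
          _ ≤ _ := mul_le_mul_of_nonneg_right hyy (norm_nonneg _)
      exact le_of_mul_le_mul_left h5 (by linarith)
  have hPall : ∀ l, 1 ≤ l → l ≤ 2 * k → P l := by
    intro l
    induction l using Nat.strong_induction_on with
    | _ l ih =>
      intro h1 h2
      rcases Nat.even_or_odd' l with ⟨c, rfl | rfl⟩
      · exact hPdouble c (by omega) (ih c (by omega) (by omega) (by omega))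
      · rcases Nat.eq_zero_or_pos c with rfl | hc
        · exact hP1
        · exact hPdown _ (hPdouble (c + 1) (by omega) (ih (c + 1) (by omega) (by omega) (by omega)))
  obtain ⟨u, A, hA, -, h2, h3⟩ := hPall (2 * k) (by omega) le_rfl
  have hu : u = [] := by
    rw [List.length_append, alt_length] at h2
    exact List.length_eq_zero_iff.1 (by omega)
  subst hu
  rw [List.nil_append, alt_prod] at h3
  linarith [hS A hA]

section
open scoped ComplexOrder

lemma posSemidef_pow_mul (B : Matrix n n ℂ) (k : ℕ) : ((B * Bᴴ) ^ k).PosSemidef :=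
  (Matrix.posSemidef_self_mul_conjTranspose B).pow k

lemma norm_trace_eq (B : Matrix n n ℂ) (k : ℕ) :
    ‖((B * Bᴴ) ^ k).trace‖ = ((B * Bᴴ) ^ k).trace.re := by
  have h := (posSemidef_pow_mul B k).trace_nonneg
  have h2 := congrArg Complex.re (Complex.norm_of_nonneg' h)
  simpa using h2

lemma herm_pow_zero (H : Matrix n n ℂ) (hH : Hᴴ = H) (k : ℕ) (h : H ^ k = 0) : H = 0 := by
  have h2 : ∀ m : ℕ, H ^ (2 ^ m) = 0 → H = 0 := by
    intro m
    induction m with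
    | zero => intro h; simpa using h
    | succ m ih =>
      intro h
      apply ih
      apply Matrix.conjTranspose_mul_self_eq_zero.1
      rw [conjTranspose_pow, hH, ← pow_add, ← two_mul, ← pow_succ', h]
  exact h2 k (pow_eq_zero_of_le Nat.lt_two_pow_self.le h)

lemma eq_zero_of_trace (B : Matrix n n ℂ) (k : ℕ)
    (h : ((B * Bᴴ) ^ k).trace.re = 0) : B = 0 := by
  rw [← norm_trace_eq, norm_eq_zero, (posSemidef_pow_mul B k).trace_eq_zero_iff] at h
  have := herm_pow_zero _ (by simp) k h
  exact Matrix.self_mul_conjTranspose_eq_zero.1 this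

end

lemma ofFn_smul_prod (m : ℕ) (t : Fin m → ℂ) (C : Fin m → Matrix n n ℂ) :
    (List.ofFn fun j => t j • C j).prod = (∏ j, t j) • (List.ofFn C).prod := by
  induction m with
  | zero => simp
  | succ m ih =>
    rw [List.ofFn_succ, List.prod_cons, ih, List.ofFn_succ, List.prod_cons, Fin.prod_univ_succ,
      smul_mul_smul_comm]

end TraceHolder

open TraceHolder in
/-- For `2k` complex square matrices `B₁, …, B_{2k}` of the same size,
`|Tr(B₁B₂⋯B_{2k})| ≤ ∏ⱼ (Tr((BⱼBⱼ*)^k))^{1/(2k)}`. -/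
theorem abs_trace_prod_le_prod_trace_rpow
    {n : Type*} [Fintype n] [DecidableEq n]
    (k : ℕ) (hk : 1 ≤ k) (B : Fin (2 * k) → Matrix n n ℂ) :
    ‖((List.ofFn B).prod).trace‖ ≤
      ∏ j : Fin (2 * k), (((B j * (B j)ᴴ) ^ k).trace.re) ^ ((1 : ℝ) / (2 * k)) := by
  have hnn : ∀ j, 0 ≤ ((B j * (B j)ᴴ) ^ k).trace.re := fun j => by
    rw [← norm_trace_eq]; exact norm_nonneg _
  by_cases hz : ∃ j, ((B j * (B j)ᴴ) ^ k).trace.re = 0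
  · obtain ⟨j, hj⟩ := hz
    have hB := eq_zero_of_trace _ _ hj
    have : (List.ofFn B).prod = 0 := List.prod_eq_zero (by
      rw [List.mem_ofFn]; exact ⟨j, hB⟩)
    rw [this]
    simp only [trace_zero, norm_zero]
    exact Finset.prod_nonneg fun j _ => Real.rpow_nonneg (hnn j) _
  push Not at hz
  set t : Fin (2 * k) → ℝ := fun j => (((B j * (B j)ᴴ) ^ k).trace.re) ^ ((1 : ℝ) / (2 * k)) with ht
  have htpos : ∀ j, 0 < t j := fun j => Real.rpow_pos_of_pos ((hnn j).lt_of_ne' (hz j)) _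
  have htpow : ∀ j, t j ^ (2 * k) = ((B j * (B j)ᴴ) ^ k).trace.re := fun j => by
    have := Real.rpow_inv_natCast_pow (hnn j) (n := 2 * k) (by omega)
    rw [← this, ht]
    simp
  let C : Fin (2 * k) → Matrix n n ℂ := fun j => ((t j)⁻¹ : ℂ) • B j
  have hBC : B = fun j => (t j : ℂ) • C j := by
    funext j
    have : (t j : ℂ) ≠ 0 := by exact_mod_cast (htpos j).ne'
    simp [C, smul_smul, this]
  have hC1 : ∀ j, ‖((C j * (C j)ᴴ) ^ k).trace‖ ≤ 1 := by
    intro j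
    have e : (C j * (C j)ᴴ) ^ k = (((t j)⁻¹ ^ (2 * k) : ℝ) : ℂ) • (B j * (B j)ᴴ) ^ k := by
      simp only [C, conjTranspose_smul, smul_mul_smul_comm, smul_pow]
      congr 1
      simp [pow_mul, sq]
    rw [e, trace_smul, norm_smul, norm_trace_eq, ← htpow, Complex.norm_real,
      Real.norm_of_nonneg (by have := htpos j; positivity), inv_pow,
      inv_mul_cancel₀ (pow_pos (htpos j) _).ne']
  have hC2 : ∀ j, ‖(((C j)ᴴ * (C j)ᴴᴴ) ^ k).trace‖ ≤ 1 := by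
    intro j
    have e : (((C j)ᴴ * (C j)ᴴᴴ) ^ k).trace = ((C j * (C j)ᴴ) ^ k).trace := by
      rw [conjTranspose_conjTranspose]
      obtain ⟨m, rfl⟩ : ∃ m, k = m + 1 := ⟨k - 1, by omega⟩
      rw [pow_succ, ← mul_assoc, Matrix.trace_mul_comm, ← mul_assoc, ← mul_pow_mul,
        pow_succ, mul_assoc]
    rw [e]
    exact hC1 j
  have hmain : ‖(List.ofFn C).prod.trace‖ ≤ 1 := by
    refine main_bound (Set.range C ∪ Set.range fun j => (C j)ᴴ)
      ((Set.finite_range _).union (Set.finite_range _)) ?_ k hk ?_ _ ?_ (by simp)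
    · rintro A (⟨j, rfl⟩ | ⟨j, rfl⟩)
      · exact Or.inr ⟨j, rfl⟩
      · exact Or.inl ⟨j, by simp⟩
    · rintro A (⟨j, rfl⟩ | ⟨j, rfl⟩)
      · exact hC1 j
      · exact hC2 j
    · intro A hA
      rw [List.mem_ofFn] at hA
      exact Or.inl hA
  have hprod : (List.ofFn B).prod = (∏ j, (t j : ℂ)) • (List.ofFn C).prod := by
    rw [← ofFn_smul_prod, ← hBC]
  rw [hprod, trace_smul, norm_smul, norm_prod]
  have : ∏ j, ‖(t j : ℂ)‖ = ∏ j, t j := Finset.prod_congr rfl fun j _ => by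
    rw [Complex.norm_real, Real.norm_of_nonneg (htpos j).le]
  rw [this]
  exact mul_le_of_le_one_right (Finset.prod_nonneg fun j _ => (htpos j).le) hmain
end
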